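/- Let K be an algebraically closed field equipped with a valuation v : K → ℝ ∪ {∞} (so v(ab) = v(a) + v(b), v(a+b) ≥ min(v(a), v(b)), and v(a) = ∞ iff a = 0) such that v is surjective onto ℝ ∪ {∞}. Let I ⊆ K[x₁,…,xₙ] be an ideal. Then the intersection, over all nonzero f ∈ I, of the corner loci T(trop(f)) equals the closure in ℝⁿ of the set {(v(p₁),…,v(pₙ)) : p ∈ (K*)ⁿ and f(p) = 0 for all f ∈ I}. -/

import Mathlib

open MvPolynomial

/-- The tropical value `v(c_a) + ⟨a, w⟩` of the term of `f` with exponent `a`,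
at the weight vector `w`, for a valuation `v` with values in `ℝ ∪ {∞}`. -/
noncomputable def tropTerm {K : Type*} [Field K] {n : ℕ} (v : K → WithTop ℝ)
    (f : MvPolynomial (Fin n) K) (w : Fin n → ℝ) (a : Fin n →₀ ℕ) : WithTop ℝ :=
  v (coeff a f) + ((∑ i, (a i : ℝ) * w i : ℝ) : WithTop ℝ)

/-- The corner locus `T(trop(f))` of the tropicalization of `f`: the set of
weight vectors `w` at which the minimum of `v(c_a) + ⟨a, w⟩` over the support
of `f` is attained by at least two distinct exponents. -/
noncomputable def cornerLocus {K : Type*} [Field K] {n : ℕ} (v : K → WithTop ℝ)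
    (f : MvPolynomial (Fin n) K) : Set (Fin n → ℝ) :=
  {w | ∃ a ∈ f.support, ∃ b ∈ f.support, a ≠ b ∧
    tropTerm v f w a = tropTerm v f w b ∧
    ∀ e ∈ f.support, tropTerm v f w a ≤ tropTerm v f w e}

section Specialization

open Polynomial Filter

variable {K L Γ : Type*} [Field K] [Field L] [Algebra K L]
  [LinearOrderedCommGroupWithZero Γ] (v : Valuation L Γ)

/-- The filter on `K` of elements whose value realizes the same cut in the value group of `K`
as `γ`. -/
def cutFilter (K : Type*) [Field K] [Algebra K L] (v : Valuation L Γ) (γ : Γ) : Filter K :=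
  ⨅ e : K, 𝓟 {d | (v (algebraMap K L e) < γ → v (algebraMap K L e) < v (algebraMap K L d)) ∧
    (γ < v (algebraMap K L e) → v (algebraMap K L d) < v (algebraMap K L e))}

lemma eventually_cutFilter (γ : Γ) (e : K) : ∀ᶠ d in cutFilter K v γ,
    (v (algebraMap K L e) < γ → v (algebraMap K L e) < v (algebraMap K L d)) ∧
    (γ < v (algebraMap K L e) → v (algebraMap K L d) < v (algebraMap K L e)) :=
  mem_iInf_of_mem e (mem_principal_self _)

lemma exists_cut [IsAlgClosed K] {γ : Γ} (hγ : 0 < γ) {π : K} (hπ0 : π ≠ 0)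
    (hπ : v (algebraMap K L π) < 1) (E : Finset K) : ∃ d : K, ∀ e ∈ E,
    (v (algebraMap K L e) < γ → v (algebraMap K L e) < v (algebraMap K L d)) ∧
    (γ < v (algebraMap K L e) → v (algebraMap K L d) < v (algebraMap K L e)) := by
  classical
  have hpos : ∀ {x : K}, x ≠ 0 → 0 < v (algebraMap K L x) := fun hx => by
    rw [Valuation.pos_iff]; simpa using hx
  obtain ⟨a, ha, hamax⟩ := ({e ∈ insert 0 E | v (algebraMap K L e) < γ} : Finset K).exists_max_image
    (fun e => v (algebraMap K L e)) ⟨0, by simpa using hγ⟩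
  have hlow : ∀ e ∈ E, v (algebraMap K L e) < γ → v (algebraMap K L e) ≤ v (algebraMap K L a) :=
    fun e he h => hamax e (by simp [he, h])
  have haγ : v (algebraMap K L a) < γ := (Finset.mem_filter.1 ha).2
  suffices ∃ d : K, v (algebraMap K L a) < v (algebraMap K L d) ∧
      ∀ e ∈ E, γ < v (algebraMap K L e) → v (algebraMap K L d) < v (algebraMap K L e) by
    obtain ⟨d, hd, hd'⟩ := this
    exact ⟨d, fun e he => ⟨fun h => (hlow e he h).trans_lt hd, hd' e he⟩⟩
  rcases ({e ∈ E | γ < v (algebraMap K L e)} : Finset K).eq_empty_or_nonempty with h | h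
  · have hE : ∀ e ∈ E, ¬ γ < v (algebraMap K L e) := by simpa [Finset.filter_eq_empty_iff] using h
    rcases eq_or_ne a 0 with rfl | ha0
    · exact ⟨1, by simp, fun e he h => absurd h (hE e he)⟩
    · refine ⟨a * π⁻¹, ?_, fun e he h => absurd h (hE e he)⟩
      rw [map_mul, map_mul, map_inv₀, map_inv₀]
      exact lt_mul_of_one_lt_right (hpos ha0) ((one_lt_inv₀ (hpos hπ0)).2 hπ)
  · obtain ⟨b, hb, hbmin⟩ := Finset.exists_min_image _ (fun e => v (algebraMap K L e)) h
    have hγb := (Finset.mem_filter.1 hb).2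
    have hb0 : b ≠ 0 := by rintro rfl; simp at hγb
    suffices ∃ d : K, v (algebraMap K L a) < v (algebraMap K L d) ∧
        v (algebraMap K L d) < v (algebraMap K L b) by
      obtain ⟨d, hd, hd'⟩ := this
      exact ⟨d, hd, fun e he h => hd'.trans_le (hbmin e (by simp [he, h]))⟩
    rcases eq_or_ne a 0 with rfl | ha0
    · refine ⟨b * π, by simp [hb0, hπ0, zero_lt_iff], ?_⟩
      rw [map_mul, map_mul]
      exact mul_lt_of_lt_one_right (hpos hb0) hπ
    · obtain ⟨d, hd⟩ := IsAlgClosed.exists_pow_nat_eq (a * b) (n := 2) two_pos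
      have hab := haγ.trans hγb
      have hv : v (algebraMap K L d) ^ 2 = v (algebraMap K L a) * v (algebraMap K L b) := by
        rw [← map_pow, ← map_pow, hd, map_mul, map_mul]
      refine ⟨d, ?_, ?_⟩
      · refine lt_of_pow_lt_pow_left₀ 2 zero_le ?_
        rw [hv, sq]
        exact mul_lt_mul_of_pos_left hab (hpos ha0)
      · refine lt_of_pow_lt_pow_left₀ 2 zero_le ?_
        rw [hv, sq]
        exact mul_lt_mul_of_pos_right hab (hpos hb0)

lemma cutFilter_neBot [IsAlgClosed K] {γ : Γ} (hγ : 0 < γ) {π : K} (hπ0 : π ≠ 0)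
    (hπ : v (algebraMap K L π) < 1) : (cutFilter K v γ).NeBot := by
  refine (hasBasis_iInf_principal_finite _).neBot_iff.2 fun {s} hs => ?_
  obtain ⟨d, hd⟩ := exists_cut v hγ hπ0 hπ hs.toFinset
  exact ⟨d, Set.mem_iInter₂.2 fun e he => hd e (hs.mem_toFinset.2 he)⟩

lemma eventually_mul_pow_le [IsAlgClosed K] {γ : Γ} (hγ : 0 < γ)
    (hγK : ∀ e : K, v (algebraMap K L e) ≠ γ) {a b : K} (ha : a ≠ 0) (hb : b ≠ 0) {k l : ℕ}
    (h : v (algebraMap K L a) * γ ^ k ≤ v (algebraMap K L b) * γ ^ l) :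
    ∀ᶠ d in cutFilter K v γ, v (algebraMap K L a) * v (algebraMap K L d) ^ k ≤
      v (algebraMap K L b) * v (algebraMap K L d) ^ l := by
  have hpos : ∀ {x : K}, x ≠ 0 → 0 < v (algebraMap K L x) := fun hx => by
    rw [Valuation.pos_iff]; simpa using hx
  rcases le_total k l with hkl | hkl
  · obtain ⟨m, rfl⟩ := Nat.exists_eq_add_of_le hkl
    rcases Nat.eq_zero_or_pos m with rfl | hm
    · refine .of_forall fun d => ?_
      exact mul_le_mul_left (le_of_mul_le_mul_right h (pow_pos hγ k)) _
    obtain ⟨e, he⟩ := IsAlgClosed.exists_pow_nat_eq (a / b) hm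
    have hv : v (algebraMap K L a) = v (algebraMap K L b) * v (algebraMap K L e) ^ m := by
      rw [← map_pow, ← map_pow, he, ← map_mul, ← map_mul, mul_div_cancel₀ _ hb]
    have hle : v (algebraMap K L e) < γ := by
      refine lt_of_le_of_ne ?_ (hγK e)
      rw [hv, pow_add, mul_assoc, mul_comm (γ ^ k)] at h
      exact le_of_pow_le_pow_left₀ hm.ne' zero_le
        (le_of_mul_le_mul_right (le_of_mul_le_mul_left h (hpos hb)) (pow_pos hγ k))
    filter_upwards [eventually_cutFilter v γ e] with d hd
    rw [hv, pow_add, mul_assoc, mul_comm (v (algebraMap K L d) ^ k)]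
    gcongr
    exact (hd.1 hle).le
  · obtain ⟨m, rfl⟩ := Nat.exists_eq_add_of_le hkl
    rcases Nat.eq_zero_or_pos m with rfl | hm
    · refine .of_forall fun d => ?_
      exact mul_le_mul_left (le_of_mul_le_mul_right h (pow_pos hγ l)) _
    obtain ⟨e, he⟩ := IsAlgClosed.exists_pow_nat_eq (b / a) hm
    have hv : v (algebraMap K L b) = v (algebraMap K L a) * v (algebraMap K L e) ^ m := by
      rw [← map_pow, ← map_pow, he, ← map_mul, ← map_mul, mul_div_cancel₀ _ ha]
    have hle : γ < v (algebraMap K L e) := by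
      refine lt_of_le_of_ne ?_ (hγK e).symm
      rw [hv, pow_add, mul_assoc, mul_comm (γ ^ l)] at h
      exact le_of_pow_le_pow_left₀ hm.ne' zero_le
        (le_of_mul_le_mul_right (le_of_mul_le_mul_left h (hpos ha)) (pow_pos hγ l))
    filter_upwards [eventually_cutFilter v γ e] with d hd
    rw [hv, pow_add, mul_assoc, mul_comm (v (algebraMap K L d) ^ l)]
    gcongr
    exact (hd.2 hle).le

lemma aeval_eq_mul_prod_roots [IsAlgClosed K] (f : K[X]) (t : L) :
    aeval t f = algebraMap K L f.leadingCoeff *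
      (f.roots.map fun α => t - algebraMap K L α).prod := by
  conv_lhs => rw [(IsAlgClosed.splits f).eq_prod_roots]
  simp [map_multiset_prod, Multiset.map_map]

lemma exists_monomial_approx [IsAlgClosed K] {t : L} {α : K} {γ : Γ}
    (hγt : v (t - algebraMap K L α) = γ) (hγK : ∀ e : K, v (algebraMap K L e) ≠ γ)
    {f : K[X]} (hf : f ≠ 0) :
    ∃ (a : K) (k : ℕ), a ≠ 0 ∧ v (aeval t f) = v (algebraMap K L a) * γ ^ k ∧
      ∀ᶠ d in cutFilter K v γ, v (algebraMap K L (f.eval (α + d))) =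
        v (algebraMap K L a) * v (algebraMap K L d) ^ k := by
  have key : ∀ s : Multiset K, ∃ (a : K) (k : ℕ), a ≠ 0 ∧
      v (s.map fun β => t - algebraMap K L β).prod = v (algebraMap K L a) * γ ^ k ∧
      ∀ᶠ d in cutFilter K v γ,
        v (s.map fun β => algebraMap K L (α + d) - algebraMap K L β).prod =
          v (algebraMap K L a) * v (algebraMap K L d) ^ k := by
    intro s
    induction s using Multiset.induction_on with
    | empty => exact ⟨1, 0, one_ne_zero, by simp, by simp⟩
    | cons β s ih =>
      obtain ⟨a, k, ha, hat, had⟩ := ih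
      have e1 : t - algebraMap K L β = (t - algebraMap K L α) - algebraMap K L (β - α) := by
        rw [map_sub]; ring
      have e2 : ∀ d, algebraMap K L (α + d) - algebraMap K L β =
          algebraMap K L d - algebraMap K L (β - α) := by
        intro d; rw [map_sub, map_add]; ring
      rcases lt_or_gt_of_ne (hγK (β - α)) with h | h
      · refine ⟨a, k + 1, ha, ?_, ?_⟩
        · rw [Multiset.map_cons, Multiset.prod_cons, map_mul, hat, e1,
            Valuation.map_sub_eq_of_lt_left v (hγt.symm ▸ h), hγt, pow_succ]
          ac_rfl
        · filter_upwards [had, eventually_cutFilter v γ (β - α)] with d hd hc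
          rw [Multiset.map_cons, Multiset.prod_cons, map_mul, hd, e2,
            Valuation.map_sub_eq_of_lt_left v (hc.1 h), pow_succ]
          ac_rfl
      · have h0 : β - α ≠ 0 := by
          intro h0; rw [h0] at h; simp at h
        refine ⟨a * (β - α), k, mul_ne_zero ha h0, ?_, ?_⟩
        · rw [Multiset.map_cons, Multiset.prod_cons, map_mul, hat, e1,
            Valuation.map_sub_eq_of_lt_right v (hγt.symm ▸ h), map_mul, map_mul]
          ac_rfl
        · filter_upwards [had, eventually_cutFilter v γ (β - α)] with d hd hc
          rw [Multiset.map_cons, Multiset.prod_cons, map_mul, hd, e2,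
            Valuation.map_sub_eq_of_lt_right v (hc.2 h), map_mul, map_mul]
          ac_rfl
  obtain ⟨a, k, ha, hat, had⟩ := key f.roots
  refine ⟨f.leadingCoeff * a, k, mul_ne_zero (leadingCoeff_ne_zero.2 hf) ha, ?_, ?_⟩
  · rw [aeval_eq_mul_prod_roots, map_mul, hat, map_mul, map_mul, mul_assoc]
  · filter_upwards [had] with d hd
    rw [← aeval_algebraMap_apply_eq_algebraMap_eval, aeval_eq_mul_prod_roots, map_mul, hd,
      map_mul, map_mul, mul_assoc]

lemma exists_unit_sub_unit [IsAlgClosed K] (E : Finset K) :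
    ∃ u : K, ∀ e ∈ E, v (algebraMap K L e) ≤ 1 → v (algebraMap K L (u - e)) = 1 := by
  classical
  set F := {e ∈ E | v (algebraMap K L e) ≤ 1} with hF
  rcases F.eq_empty_or_nonempty with h | h
  · refine ⟨0, fun e he h1 => ?_⟩
    have : e ∈ F := by simp [hF, he, h1]
    simp [h] at this
  have hmonic : (∏ e ∈ F, (Polynomial.X - Polynomial.C e)).Monic := monic_prod_X_sub_C _ _
  have hdeg : (∏ e ∈ F, (Polynomial.X - Polynomial.C e)).natDegree = F.card := by simp
  obtain ⟨u, hu⟩ := IsAlgClosed.exists_root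
    (∏ e ∈ F, (Polynomial.X - Polynomial.C e) - Polynomial.C 1) (by
    rw [degree_sub_C (by rw [← natDegree_pos_iff_degree_pos, hdeg]; exact h.card_pos),
      degree_eq_natDegree hmonic.ne_zero, hdeg]
    exact_mod_cast h.card_pos.ne')
  have hprod : ∏ e ∈ F, v (algebraMap K L (u - e)) = 1 := by
    have : ∏ e ∈ F, (u - e) = 1 := by
      simpa [IsRoot.def, Polynomial.eval_prod, sub_eq_zero] using hu
    rw [← map_prod, ← map_prod, this, map_one, map_one]
  have hF1 : ∀ e ∈ F, v (algebraMap K L e) ≤ 1 := fun e he => (Finset.mem_filter.1 he).2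
  have hu1 : v (algebraMap K L u) ≤ 1 := by
    by_contra! hlt
    have : ∀ e ∈ F, v (algebraMap K L (u - e)) = v (algebraMap K L u) := fun e he => by
      rw [map_sub]
      exact Valuation.map_sub_eq_of_lt_left v ((hF1 e he).trans_lt hlt)
    rw [Finset.prod_congr rfl this, Finset.prod_const] at hprod
    exact (one_lt_pow₀ hlt h.card_pos.ne').ne' hprod
  have hle : ∀ e ∈ F, v (algebraMap K L (u - e)) ≤ 1 := fun e he => by
    rw [map_sub]
    exact (v.map_sub _ _).trans (max_le hu1 (hF1 e he))
  refine ⟨u, fun e he h1 => ?_⟩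
  exact (Finset.prod_eq_one_iff_of_le_one' hle).1 hprod e (by simp [hF, he, h1])

lemma exists_val_sub_eq [IsAlgClosed K] {t : L} (ht : t ∉ Set.range (algebraMap K L))
    (h : ∀ α : K, ∃ e : K, v (algebraMap K L e) = v (t - algebraMap K L α)) (A : Finset K) :
    ∃ c : K, ∀ α ∈ A, v (algebraMap K L (c - α)) = v (t - algebraMap K L α) := by
  classical
  rcases A.eq_empty_or_nonempty with rfl | hA
  · exact ⟨0, by simp⟩
  obtain ⟨α₀, -, hmin⟩ := A.exists_min_image (fun α => v (t - algebraMap K L α)) hA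
  obtain ⟨d, hd⟩ := h α₀
  have hd0 : d ≠ 0 := by
    rintro rfl
    rw [map_zero, map_zero, eq_comm, map_eq_zero, sub_eq_zero] at hd
    exact ht ⟨_, hd.symm⟩
  have hvd : 0 < v (algebraMap K L d) := by rw [Valuation.pos_iff]; simpa using hd0
  obtain ⟨u, hu⟩ := exists_unit_sub_unit v (insert 0 (A.image fun α => (α - α₀) / d))
  have hu1 : v (algebraMap K L u) = 1 := by simpa using hu 0 (by simp) (by simp)
  refine ⟨α₀ + d * u, fun α hα => ?_⟩
  set e := (α - α₀) / d with he
  have hde : d * e = α - α₀ := mul_div_cancel₀ _ hd0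
  have e1 : α₀ + d * u - α = d * (u - e) := by rw [mul_sub, hde]; ring
  have e2 : t - algebraMap K L α =
      (t - algebraMap K L α₀) - algebraMap K L d * algebraMap K L e := by
    rw [← map_mul, hde, map_sub]; ring
  rw [e1, map_mul, map_mul]
  rcases le_or_gt (v (algebraMap K L e)) 1 with h1 | h1
  · rw [hu e (Finset.mem_insert_of_mem (Finset.mem_image_of_mem _ hα)) h1, mul_one]
    refine le_antisymm (hd ▸ hmin α hα) ?_
    rw [e2]
    refine (v.map_sub _ _).trans (max_le hd.ge ?_)
    rw [map_mul]
    exact mul_le_of_le_one_right' h1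
  · rw [e2, Valuation.map_sub_eq_of_lt_right v, map_sub,
      Valuation.map_sub_eq_of_lt_right v (hu1 ▸ h1), map_mul]
    rw [map_mul, ← hd]
    exact lt_mul_of_one_lt_right hvd h1

/-- Finitely many comparisons between values of polynomials at a transcendental element `t` can be
realized at an element of the algebraically closed base field. -/
theorem exists_eval_le_eval [IsAlgClosed K] {π : K} (hπ0 : π ≠ 0)
    (hπ : v (algebraMap K L π) < 1) {t : L} (ht : t ∉ Set.range (algebraMap K L))
    (T : Finset K[X]) (hT : ∀ f ∈ T, f ≠ 0) :
    ∃ c : K, (∀ f ∈ T, f.eval c ≠ 0) ∧ ∀ f ∈ T, ∀ g ∈ T, v (aeval t f) ≤ v (aeval t g) →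
      v (algebraMap K L (f.eval c)) ≤ v (algebraMap K L (g.eval c)) := by
  classical
  have htα : ∀ α : K, t - algebraMap K L α ≠ 0 := fun α h => ht ⟨α, (sub_eq_zero.1 h).symm⟩
  by_cases h : ∀ α : K, ∃ e : K, v (algebraMap K L e) = v (t - algebraMap K L α)
  · obtain ⟨c, hc⟩ := exists_val_sub_eq v ht h (T.biUnion fun f => f.roots.toFinset)
    have hval : ∀ f ∈ T, v (algebraMap K L (f.eval c)) = v (aeval t f) := fun f hf => by
      rw [← aeval_algebraMap_apply_eq_algebraMap_eval, aeval_eq_mul_prod_roots,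
        aeval_eq_mul_prod_roots, map_mul, map_mul, map_multiset_prod, map_multiset_prod,
        Multiset.map_map, Multiset.map_map]
      congr 2
      refine Multiset.map_congr rfl fun α hα => ?_
      simp only [Function.comp_apply]
      rw [← map_sub]
      exact hc α (Finset.mem_biUnion.2 ⟨f, hf, Multiset.mem_toFinset.2 hα⟩)
    refine ⟨c, fun f hf h0 => ?_, fun f hf g hg hfg => by rwa [hval f hf, hval g hg]⟩
    have h1 := hval f hf
    rw [h0, map_zero, map_zero, eq_comm, map_eq_zero, aeval_eq_mul_prod_roots, mul_eq_zero,
      Multiset.prod_eq_zero_iff, Multiset.mem_map] at h1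
    rcases h1 with h1 | ⟨α, -, h1⟩
    · exact hT f hf (by simpa using h1)
    · exact htα α h1
  · push Not at h
    obtain ⟨α, hα⟩ := h
    obtain ⟨γ, hγ⟩ : ∃ γ, v (t - algebraMap K L α) = γ := ⟨_, rfl⟩
    rw [hγ] at hα
    have hγ0 : 0 < γ := hγ ▸ (Valuation.pos_iff v).2 (htα α)
    have := cutFilter_neBot v hγ0 hπ0 hπ
    choose! a k ha hat had using fun (f : K[X]) (hf : f ≠ 0) => exists_monomial_approx v hγ hα hf
    have hall : ∀ᶠ d in cutFilter K v γ, d ≠ 0 ∧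
        (∀ f ∈ T, v (algebraMap K L (f.eval (α + d))) =
          v (algebraMap K L (a f)) * v (algebraMap K L d) ^ k f) ∧
        ∀ f ∈ T, ∀ g ∈ T, v (aeval t f) ≤ v (aeval t g) →
          v (algebraMap K L (a f)) * v (algebraMap K L d) ^ k f ≤
          v (algebraMap K L (a g)) * v (algebraMap K L d) ^ k g := by
      refine .and ?_ (.and ?_ ?_)
      · filter_upwards [eventually_cutFilter v γ (0 : K)] with d hd
        rintro rfl
        simpa using hd.1 (by simpa using hγ0)
      · exact (Filter.eventually_all_finset T).2 fun f hf => had f (hT f hf)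
      · refine (Filter.eventually_all_finset T).2 fun f hf =>
          (Filter.eventually_all_finset T).2 fun g hg => Filter.eventually_imp_distrib_left.2 ?_
        intro hfg
        rw [hat f (hT f hf), hat g (hT g hg)] at hfg
        exact eventually_mul_pow_le v hγ0 hα (ha f (hT f hf)) (ha g (hT g hg)) hfg
    obtain ⟨d, hd0, hd, hdle⟩ := hall.exists
    refine ⟨α + d, fun f hf h0 => ?_, fun f hf g hg hfg => ?_⟩
    · have h1 := hd f hf
      rw [h0, map_zero, map_zero, eq_comm] at h1
      simp [ha f (hT f hf), hd0] at h1
    · rw [hd f hf, hd g hg]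
      exact hdle f hf g hg hfg

end Specialization

section Places

open Polynomial

/-- A prime ideal of `R` containing the kernel of a map to a field `L` is the center of some
valuation subring of `L`. -/
theorem exists_valuationSubring_center {R L : Type*} [CommRing R] [Field L] (φ : R →+* L)
    (P : Ideal R) [P.IsPrime] (hP : RingHom.ker φ ≤ P) :
    ∃ U : ValuationSubring L, (∀ r, φ r ∈ U) ∧ ∀ r, r ∈ P ↔ U.valuation (φ r) < 1 := by
  have hunit : ∀ y : P.primeCompl, IsUnit (φ y) := fun y =>
    isUnit_iff_ne_zero.2 fun h => y.2 (hP h)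
  let φ' : Localization.AtPrime P →+* L := IsLocalization.lift hunit
  obtain ⟨U, hU, hloc⟩ := IsLocalRing.exists_factor_valuationRing φ'
  have hφ : ∀ r, φ' (algebraMap R _ r) = φ r := fun r => IsLocalization.lift_eq hunit r
  have hmem : ∀ r, φ r ∈ U := fun r => hφ r ▸ hU _
  refine ⟨U, hmem, fun r => ?_⟩
  rw [← IsLocalization.AtPrime.to_map_mem_maximal_iff (Localization.AtPrime P) P r,
    IsLocalRing.mem_maximalIdeal, mem_nonunits_iff, ← not_iff_not, not_not,
    ← isUnit_map_iff (φ'.codRestrict U.toSubring hU)]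
  have hle : U.valuation (φ r) ≤ 1 := (U.valuation_le_one_iff _).2 (hmem r)
  have := U.valuation_eq_one_iff ⟨φ r, hmem r⟩
  have e : φ'.codRestrict U.toSubring hU (algebraMap R _ r) = ⟨φ r, hmem r⟩ :=
    Subtype.ext (hφ r)
  rw [e]
  exact this.trans ⟨fun h => by simp [h], fun h => le_antisymm hle (not_lt.1 h)⟩

lemma isIntegral_of_forall_valuationSubring {R L : Type*} [CommRing R] [Field L] [Algebra R L]
    {x : L} (h : ∀ U : ValuationSubring L, (∀ r, algebraMap R L r ∈ U) → x ∈ U) :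
    IsIntegral R x := by
  have hx : x ∈ (⨅ V : {V : ValuationSubring L //
      Set.range (algebraMap R L) ⊆ V.toSubring}, V.1.toSubring) := by
    simp only [Subring.mem_iInf]
    exact fun V => h V.1 fun r => V.2 ⟨r, rfl⟩
  rw [iInf_valuationSubring_superset] at hx
  have hx' : IsIntegral (Subring.closure (Set.range (algebraMap R L))) x := hx
  obtain ⟨p, hp, hpx⟩ := hx'
  have hcl : ∀ y ∈ Subring.closure (Set.range (algebraMap R L)), y ∈ (algebraMap R L).range :=
    fun y hy => (Subring.closure_le (t := (algebraMap R L).range)).2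
      (by rintro _ ⟨r, rfl⟩; exact ⟨r, rfl⟩) hy
  obtain ⟨q, hq, -, hqm⟩ := lifts_and_natDegree_eq_and_monic (f := algebraMap R L)
    (p := p.map (algebraMap _ L)) ((lifts_iff_coeff_lifts _).2 fun n => by
      rw [Polynomial.coeff_map]
      exact hcl _ (p.coeff n).2) (hp.map _)
  refine ⟨q, hqm, ?_⟩
  rw [← Polynomial.eval_map, hq, Polynomial.eval_map]
  exact hpx

lemma sum_coeff_eq_zero_split {R L : Type*} [CommRing R] [Field L] [Algebra R L] {x : L}
    (p : R[X]) (hp : aeval x p = 0) (j : ℕ) :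
    ∑ k ∈ Finset.range j, algebraMap R L (p.coeff k) * x ^ k +
      x ^ j * ∑ k ∈ Finset.range (p.natDegree + 1), algebraMap R L (p.coeff (j + k)) * x ^ k
        = 0 := by
  rw [← hp, aeval_eq_sum_range' (n := j + (p.natDegree + 1)) (by omega),
    Finset.sum_range_add _ j (p.natDegree + 1), Finset.mul_sum]
  simp only [Algebra.smul_def]
  congr 1
  exact Finset.sum_congr rfl fun k _ => by rw [pow_add]; ring

/-- An element of a valuation ring that is a root of a primitive polynomial over a subring is a
quotient of integral elements with a unit denominator. -/
theorem exists_integral_unit_denominator {R L : Type*} [CommRing R] [Field L] [Algebra R L]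
    (V : ValuationSubring L) (hV : ∀ r, algebraMap R L r ∈ V) {x : L} (hx : x ∈ V) (p : R[X])
    (hp : aeval x p = 0) (hu : ∃ k, V.valuation (algebraMap R L (p.coeff k)) = 1) :
    ∃ b, V.valuation b = 1 ∧ IsIntegral R b ∧ IsIntegral R (b * x) := by
  classical
  obtain ⟨k, hk⟩ := hu
  have hkp : k ≤ p.natDegree := by
    by_contra! h
    rw [coeff_eq_zero_of_natDegree_lt h] at hk
    simp at hk
  let P : ℕ → Prop := fun k => V.valuation (algebraMap R L (p.coeff k)) = 1
  set j := Nat.findGreatest P p.natDegree with hj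
  have hjP : P j := Nat.findGreatest_spec hkp hk
  have hjlt : ∀ m, j < m → V.valuation (algebraMap R L (p.coeff m)) < 1 := by
    intro m hm
    refine lt_of_le_of_ne ((V.valuation_le_one_iff _).2 (hV _)) ?_
    rcases le_or_gt m p.natDegree with h | h
    · exact Nat.findGreatest_is_greatest hm h
    · rw [coeff_eq_zero_of_natDegree_lt h]; simp
  have hx1 : V.valuation x ≤ 1 := (V.valuation_le_one_iff _).2 hx
  set b := ∑ k ∈ Finset.range (p.natDegree + 1), algebraMap R L (p.coeff (j + k)) * x ^ k with hb
  have hsplit : ∑ k ∈ Finset.range j, algebraMap R L (p.coeff k) * x ^ k + x ^ j * b = 0 :=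
    sum_coeff_eq_zero_split p hp j
  have hsmall : ∀ U : ValuationSubring L, (∀ r, algebraMap R L r ∈ U) → b ∈ U ∧ b * x ∈ U := by
    intro U hU
    by_cases hxU : x ∈ U
    · have hbU : b ∈ U := U.toSubring.sum_mem fun k _ => U.mul_mem _ _ (hU _) (pow_mem hxU k)
      exact ⟨hbU, U.mul_mem _ _ hbU hxU⟩
    · have hx' : x⁻¹ ∈ U := (U.mem_or_inv_mem x).resolve_left hxU
      have hx0 : x ≠ 0 := by rintro rfl; exact hxU U.zero_mem
      have hbx : b * x = -∑ k ∈ Finset.range j, algebraMap R L (p.coeff k) * x⁻¹ ^ (j - 1 - k) := by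
        have : x ^ j * b = -∑ k ∈ Finset.range j, algebraMap R L (p.coeff k) * x ^ k := by
          linear_combination hsplit
        apply mul_left_cancel₀ (pow_ne_zero j hx0)
        rw [← mul_assoc, this, neg_mul, mul_neg, Finset.sum_mul, Finset.mul_sum]
        congr 1
        refine Finset.sum_congr rfl fun k hk => ?_
        have hkj := Finset.mem_range.1 hk
        obtain ⟨m, hm⟩ : ∃ m, j = k + 1 + m := ⟨j - (k + 1), by omega⟩
        have : k + 1 + m - 1 - k = m := by omega
        rw [hm, this, pow_add, pow_succ]
        have : x ^ m * x⁻¹ ^ m = 1 := by rw [← mul_pow, mul_inv_cancel₀ hx0, one_pow]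
        linear_combination (-algebraMap R L (p.coeff k) * x ^ k * x) * this
      have hbxU : b * x ∈ U := by
        rw [hbx]
        exact U.neg_mem _ (U.toSubring.sum_mem fun k _ => U.mul_mem _ _ (hU _) (pow_mem hx' _))
      refine ⟨?_, hbxU⟩
      have : b = b * x * x⁻¹ := by field_simp
      rw [this]
      exact U.mul_mem _ _ hbxU hx'
  refine ⟨b, ?_, isIntegral_of_forall_valuationSubring fun U hU => (hsmall U hU).1,
    isIntegral_of_forall_valuationSubring fun U hU => (hsmall U hU).2⟩
  rw [hb, Finset.sum_range_succ', add_comm]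
  simp only [pow_zero, mul_one, add_zero]
  rw [Valuation.map_add_eq_of_lt_left]
  · exact hjP
  · refine lt_of_lt_of_eq (Valuation.map_sum_lt _ one_ne_zero fun k _ => ?_) hjP.symm
    rw [map_mul, map_pow]
    exact mul_lt_one_of_lt_of_le (hjlt _ (by omega)) (pow_le_one₀ zero_le hx1)

lemma exists_primitive_polynomial {E : Type*} [Field E] (W : ValuationSubring E) {p : E[X]}
    (hp : p ≠ 0) : ∃ (q : W[X]) (u : E), q.map (algebraMap W E) = Polynomial.C u * p ∧
      ∃ k, q.coeff k = 1 := by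
  obtain ⟨k, hk, hmax⟩ := p.support.exists_max_image (fun k => W.valuation (p.coeff k))
    (support_nonempty.2 hp)
  have hk0 : p.coeff k ≠ 0 := mem_support_iff.1 hk
  have hmem : Polynomial.C (p.coeff k)⁻¹ * p ∈ lifts (algebraMap W E) := by
    refine (lifts_iff_coeff_lifts _).2 fun n => ?_
    suffices (Polynomial.C (p.coeff k)⁻¹ * p).coeff n ∈ W from ⟨⟨_, this⟩, rfl⟩
    rw [← W.valuation_le_one_iff, Polynomial.coeff_C_mul, map_mul, map_inv₀]
    by_cases hn : p.coeff n = 0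
    · simp [hn]
    · exact inv_mul_le_one_of_le₀ (hmax n (mem_support_iff.2 hn)) zero_le
  obtain ⟨q, hq⟩ := (lifts_iff_set_range _).1 hmem
  refine ⟨q, _, hq, k, Subtype.ext ?_⟩
  have : (q.map (algebraMap W E)).coeff k = 1 := by
    rw [hq, Polynomial.coeff_C_mul, inv_mul_cancel₀ hk0]
  rwa [Polynomial.coeff_map] at this

section Roots

variable {R F Γ : Type*} [CommRing R] [Field F] [LinearOrderedCommGroupWithZero Γ]
  (v : Valuation F Γ)

lemma val_root_le_one {f : R[X]} (hf : f.Monic) (θ : R →+* F)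
    (hc : ∀ k, v (θ (f.coeff k)) ≤ 1) {a : F} (ha : eval₂ θ a f = 0) : v a ≤ 1 := by
  by_contra! h
  rw [eval₂_eq_sum_range, Finset.sum_range_succ, hf.coeff_natDegree, map_one, one_mul,
    add_comm] at ha
  have hlt : v (∑ k ∈ Finset.range f.natDegree, θ (f.coeff k) * a ^ k) < v (a ^ f.natDegree) := by
    refine Valuation.map_sum_lt _ ?_ fun k hk => ?_
    · rw [map_pow]
      exact pow_ne_zero _ (zero_lt_one.trans h).ne'
    · rw [map_mul, map_pow, map_pow]
      exact (mul_le_of_le_one_left' (hc k)).trans_lt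
        (pow_lt_pow_right₀ h (Finset.mem_range.1 hk))
  have := Valuation.map_add_eq_of_lt_left v hlt
  rw [ha, map_zero] at this
  exact not_lt_zero (this ▸ hlt)

lemma exists_coeff_val_eq_one {f : R[X]} (hf : f.Monic) (θ : R →+* F)
    (hc : ∀ k, v (θ (f.coeff k)) ≤ 1) {a : F} (ha : eval₂ θ a f = 0) (hva : v a = 1) :
    ∃ k < f.natDegree, v (θ (f.coeff k)) = 1 := by
  by_contra! h
  rw [eval₂_eq_sum_range, Finset.sum_range_succ, hf.coeff_natDegree, map_one, one_mul,
    add_comm] at ha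
  have hlt : v (∑ k ∈ Finset.range f.natDegree, θ (f.coeff k) * a ^ k) < v (a ^ f.natDegree) := by
    rw [map_pow, hva, one_pow]
    refine Valuation.map_sum_lt _ one_ne_zero fun k hk => ?_
    rw [map_mul, map_pow, hva, one_pow, mul_one]
    exact lt_of_le_of_ne (hc k) (h k (Finset.mem_range.1 hk))
  have := Valuation.map_add_eq_of_lt_left v hlt
  rw [ha, map_zero] at this
  exact not_lt_zero (this ▸ hlt)

lemma val_coeff_prod_X_sub_C (s : Multiset F) (hs : ∀ α ∈ s, v α < 1) :
    (∀ k, v ((s.map fun α => Polynomial.X - Polynomial.C α).prod.coeff k) ≤ 1) ∧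
      ∀ k < s.card, v ((s.map fun α => Polynomial.X - Polynomial.C α).prod.coeff k) < 1 := by
  induction s using Multiset.induction_on with
  | empty =>
    refine ⟨fun k => ?_, by simp⟩
    simp only [Multiset.map_zero, Multiset.prod_zero, Polynomial.coeff_one]
    split_ifs <;> simp
  | cons α s ih =>
    obtain ⟨ih1, ih2⟩ := ih fun β hβ => hs β (Multiset.mem_cons_of_mem hβ)
    have hα := hs α (Multiset.mem_cons_self α s)
    have hαk : ∀ k,
        v (α * (s.map fun α => Polynomial.X - Polynomial.C α).prod.coeff k) < 1 := fun k => by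
      rw [map_mul]
      exact mul_lt_one_of_lt_of_le hα (ih1 k)
    rw [Multiset.map_cons, Multiset.prod_cons, Multiset.card_cons]
    refine ⟨fun k => ?_, fun k hk => ?_⟩ <;>
      rw [sub_mul, Polynomial.coeff_sub, Polynomial.coeff_C_mul]
    · refine (v.map_sub _ _).trans (max_le ?_ (hαk k).le)
      cases k with
      | zero => simp
      | succ k => rw [Polynomial.coeff_X_mul]; exact ih1 k
    · refine (v.map_sub _ _).trans_lt (max_lt ?_ (hαk k))
      cases k with
      | zero => simp
      | succ k => rw [Polynomial.coeff_X_mul]; exact ih2 k (by omega)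

lemma exists_root_val_eq_one [IsAlgClosed F] {f : F[X]} (hf : f.Monic)
    (hc : ∀ k, v (f.coeff k) ≤ 1) (h : ∃ k < f.natDegree, v (f.coeff k) = 1) :
    ∃ β, f.IsRoot β ∧ v β = 1 := by
  by_contra! hne
  obtain ⟨k, hk, hk1⟩ := h
  have hs := IsAlgClosed.splits f
  have hroots : ∀ β ∈ f.roots, v β < 1 := fun β hβ => by
    have hβ' := isRoot_of_mem_roots hβ
    exact lt_of_le_of_ne (val_root_le_one v hf (RingHom.id F) hc hβ') (hne β hβ')
  have := (val_coeff_prod_X_sub_C v f.roots hroots).2 k (by rwa [← hs.natDegree_eq_card_roots])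
  rw [← hs.eq_prod_roots_of_monic hf, hk1] at this
  exact lt_irrefl _ this

end Roots

section Congruence

variable {K L Γ : Type*} [Field K] [Field L] [Algebra K L] [LinearOrderedCommGroupWithZero Γ]
  {v : Valuation L Γ}

lemma eq_zero_of_val_algebraMap_lt_one (hK : ∀ a : K, v (algebraMap K L a) ≤ 1) {a : K}
    (ha : v (algebraMap K L a) < 1) : a = 0 := by
  by_contra h0
  have : v (algebraMap K L a) * v (algebraMap K L a⁻¹) = 1 := by
    rw [← map_mul, ← map_mul, mul_inv_cancel₀ h0, map_one, map_one]
  exact (mul_lt_one_of_lt_of_le ha (hK _)).ne this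

/-- Points congruent to each other modulo the maximal ideal of a valuation trivial on `K` satisfy
the same relations over `K`. -/
lemma aeval_eq_zero_of_congr (hK : ∀ a : K, v (algebraMap K L a) ≤ 1) {ι : Type*} {s : ι → L}
    {p : ι → K} (h : ∀ i, v (s i - algebraMap K L (p i)) < 1) (f : MvPolynomial ι K)
    (hf : MvPolynomial.aeval s f = 0) : MvPolynomial.aeval p f = 0 := by
  have key : v (MvPolynomial.aeval s f - algebraMap K L (MvPolynomial.aeval p f)) < 1 := by
    clear hf
    induction f using MvPolynomial.induction_on with
    | C a => simp
    | add f g hf hg =>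
      rw [map_add, map_add, map_add, add_sub_add_comm]
      exact v.map_add_lt hf hg
    | mul_X f i hf =>
      have hfs : v (MvPolynomial.aeval s f) ≤ 1 := by
        have := v.map_add_le hf.le (hK (MvPolynomial.aeval p f))
        rwa [sub_add_cancel] at this
      have e : MvPolynomial.aeval s (f * MvPolynomial.X i) -
          algebraMap K L (MvPolynomial.aeval p (f * MvPolynomial.X i)) =
          MvPolynomial.aeval s f * (s i - algebraMap K L (p i)) +
          (MvPolynomial.aeval s f - algebraMap K L (MvPolynomial.aeval p f)) *
            algebraMap K L (p i) := by
        simp only [map_mul, MvPolynomial.aeval_X]; ring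
      rw [e]
      refine v.map_add_lt ?_ ?_ <;> rw [map_mul]
      · exact (mul_comm _ _).trans_lt (mul_lt_one_of_lt_of_le (h i) hfs)
      · exact mul_lt_one_of_lt_of_le hf (hK _)
  rw [hf, zero_sub, Valuation.map_neg] at key
  exact eq_zero_of_val_algebraMap_lt_one hK key

lemma exists_root_congr [IsAlgClosed K] (hK : ∀ a : K, v (algebraMap K L a) ≤ 1) {R : Type*}
    [CommRing R] (θ : R →+* L) (ψ : R →+* K) (h : ∀ r, v (θ r - algebraMap K L (ψ r)) < 1)
    {g : R[X]} (hg : g.Monic) {a : L} (ha : eval₂ θ a g = 0) :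
    ∃ α, eval₂ ψ α g = 0 ∧ v (a - algebraMap K L α) < 1 := by
  have hθ : ∀ r, v (θ r) ≤ 1 := fun r => by
    have := v.map_add_le (h r).le (hK (ψ r))
    rwa [sub_add_cancel] at this
  have ha1 : v a ≤ 1 := val_root_le_one v hg θ (fun _ => hθ _) ha
  have hlt : v (aeval a (g.map ψ)) < 1 := by
    have e : aeval a (g.map ψ) = -∑ k ∈ Finset.range (g.natDegree + 1),
        (θ (g.coeff k) - algebraMap K L (ψ (g.coeff k))) * a ^ k := by
      simp only [sub_mul, Finset.sum_sub_distrib]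
      rw [← eval₂_eq_sum_range, ha, Polynomial.aeval_def, Polynomial.eval₂_map, eval₂_eq_sum_range]
      simp
    rw [e, Valuation.map_neg]
    refine Valuation.map_sum_lt _ one_ne_zero fun k _ => ?_
    rw [map_mul, map_pow]
    exact mul_lt_one_of_lt_of_le (h _) (pow_le_one₀ zero_le ha1)
  rw [aeval_eq_mul_prod_roots, (hg.map ψ).leadingCoeff, map_one, one_mul,
    map_multiset_prod, Multiset.map_map] at hlt
  by_contra! hne
  refine not_le.2 hlt (Multiset.one_le_prod_of_one_le ?_)
  intro x hx
  obtain ⟨α, hα, rfl⟩ := Multiset.mem_map.1 hx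
  refine hne α ?_
  have := isRoot_of_mem_roots hα
  rwa [IsRoot.def, Polynomial.eval_map] at this

end Congruence

end Places

section ModelCompleteness

open Polynomial

universe u

lemma ker_eval₂RingHom_le {A E K L : Type*} [CommRing A] [Field E] [Field K] [Field L]
    [Algebra E L] {φ : A →+* E}
    (hφ : Function.Injective φ) {ψ : A →+* K} {b : L} {β : K} {h : A[X]} (hm : h.Monic)
    (hmin : h.map φ = minpoly E b) (hβ : eval₂ ψ β h = 0) :
    RingHom.ker (eval₂RingHom ((algebraMap E L).comp φ) b) ≤
      RingHom.ker (eval₂RingHom ψ β) := by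
  intro q hq
  have hΦ : ∀ r : A[X], eval₂RingHom ((algebraMap E L).comp φ) b r = aeval b (r.map φ) :=
    fun r => by
      rw [Polynomial.aeval_def, Polynomial.eval₂_map]
      rfl
  rw [RingHom.mem_ker, hΦ] at hq
  have hdm := modByMonic_add_div q h
  have h1 : aeval b ((q %ₘ h).map φ) = 0 := by
    have := congrArg (fun r => aeval b (r.map φ)) hdm
    simpa [hq, hmin] using this
  have h2 : (q %ₘ h).map φ = 0 := by
    by_contra hne
    have hdle := minpoly.degree_le_of_ne_zero E b hne h1
    rw [← hmin, hm.degree_map, degree_map_eq_of_injective hφ] at hdle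
    have : Nontrivial A := φ.domain_nontrivial
    exact (degree_modByMonic_lt q hm).not_ge hdle
  have h3 : q %ₘ h = 0 := Polynomial.map_injective _ hφ (by rw [h2, Polynomial.map_zero])
  rw [h3, zero_add] at hdm
  rw [RingHom.mem_ker, ← hdm, coe_eval₂RingHom, Polynomial.eval₂_mul, hβ, zero_mul]

variable {K : Type u} {L : Type*} [Field K] [Field L] [Algebra K L]

/-- Finitely many integral elements of a simple transcendental extension `E` of `K` lift to a
subring of `E` with an integral specialization to `K`. -/
theorem exists_specialization_of_simple [IsAlgClosed K] (V : ValuationSubring L) {π : K}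
    (hπ0 : π ≠ 0) (hπ : V.valuation (algebraMap K L π) < 1) {E : Type*} [Field E] [Algebra K E]
    [Algebra E L] [IsScalarTower K E L] {t : E} (ht : t ∉ Set.range (algebraMap K E))
    (hE : ∀ r : E, ∃ f g : K[X], r = aeval t f / aeval t g) (F : Finset E)
    (hF : ∀ r ∈ F, algebraMap E L r ∈ V) :
    ∃ (A : Type u) (_ : CommRing A) (_ : Algebra K A) (φ : A →ₐ[K] E) (ψ : A →ₐ[K] K),
      Function.Injective φ ∧ ∀ r ∈ F, ∃ x, φ x = r ∧ algebraMap K L (ψ x) ∈ V := by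
  classical
  choose f g hfg using hE
  have htL : algebraMap E L t ∉ Set.range (algebraMap K L) := by
    rintro ⟨a, ha⟩
    rw [IsScalarTower.algebraMap_apply K E L] at ha
    exact ht ⟨a, (algebraMap E L).injective ha⟩
  obtain ⟨c, hc0, hc⟩ := exists_eval_le_eval V.valuation hπ0 hπ htL
    ({h ∈ F.image f ∪ F.image g | h ≠ 0}) (fun h hh => (Finset.mem_filter.1 hh).2)
  have hinj : ∀ h : K[X], aeval t h = 0 → h = 0 := by
    intro h hh
    by_contra h0
    have halg : IsAlgebraic K t := ⟨h, h0, hh⟩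
    exact ht (halg.isIntegral.mem_range_algebraMap_of_minpoly_splits (IsAlgClosed.splits _))
  let M : Submonoid K[X] := (nonZeroDivisors K).comap (aeval c : K[X] →ₐ[K] K)
  have hM : ∀ h : K[X], h ∈ M ↔ h.eval c ≠ 0 := fun h => by
    simp [M, Polynomial.coe_aeval_eq_eval]
  have hφu : ∀ y : M, IsUnit ((aeval t : K[X] →ₐ[K] E) y) := fun y =>
    isUnit_iff_ne_zero.2 fun h => by
      have := (hM y).1 y.2
      rw [hinj _ h] at this
      simp at this
  have hψu : ∀ y : M, IsUnit ((aeval c : K[X] →ₐ[K] K) y) := fun y =>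
    isUnit_iff_ne_zero.2 (by
      rw [Polynomial.coe_aeval_eq_eval]
      exact (hM y).1 y.2)
  let φ : Localization M →ₐ[K] E := IsLocalization.liftAlgHom hφu
  let ψ : Localization M →ₐ[K] K := IsLocalization.liftAlgHom hψu
  have hφmk : ∀ (a : K[X]) (b : M),
      φ (IsLocalization.mk' _ a b) * aeval t (b : K[X]) = aeval t a := by
    intro a b
    have h := (IsLocalization.lift_mk'_spec (S := Localization M)
      (g := (aeval t : K[X] →ₐ[K] E).toRingHom)
      (hg := hφu) a (φ (IsLocalization.mk' _ a b)) b).1 rfl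
    rw [mul_comm]
    exact h.symm
  have hψmk : ∀ (a : K[X]) (b : M),
      ψ (IsLocalization.mk' _ a b) * (b : K[X]).eval c = a.eval c := by
    intro a b
    have h := (IsLocalization.lift_mk'_spec (S := Localization M)
      (g := (aeval c : K[X] →ₐ[K] K).toRingHom)
      (hg := hψu) a (ψ (IsLocalization.mk' _ a b)) b).1 rfl
    rw [mul_comm]
    exact h.symm
  refine ⟨Localization M, inferInstance, inferInstance, φ, ψ, ?_, fun r hr => ?_⟩
  · rw [injective_iff_map_eq_zero]
    intro x hx
    obtain ⟨a, b, rfl⟩ := IsLocalization.exists_mk'_eq M x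
    have := hφmk a b
    rw [hx, zero_mul, eq_comm] at this
    rw [hinj a this, IsLocalization.mk'_zero]
  · rcases eq_or_ne r 0 with rfl | hr0
    · exact ⟨0, map_zero _, by simp⟩
    have hf0 : f r ≠ 0 := fun h => hr0 (by rw [hfg r, h]; simp)
    have hg0 : g r ≠ 0 := fun h => hr0 (by rw [hfg r, h]; simp)
    have hg0' : aeval t (g r) ≠ 0 := fun h => hg0 (hinj _ h)
    have hfT : f r ∈ ({h ∈ F.image f ∪ F.image g | h ≠ 0}) := Finset.mem_filter.2
      ⟨Finset.mem_union_left _ (Finset.mem_image_of_mem _ hr), hf0⟩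
    have hgT : g r ∈ ({h ∈ F.image f ∪ F.image g | h ≠ 0}) := Finset.mem_filter.2
      ⟨Finset.mem_union_right _ (Finset.mem_image_of_mem _ hr), hg0⟩
    have hgc := hc0 _ hgT
    refine ⟨IsLocalization.mk' _ (f r) ⟨g r, (hM _).2 hgc⟩, ?_, ?_⟩
    · have h := hφmk (f r) ⟨g r, (hM _).2 hgc⟩
      conv_rhs => rw [hfg r]
      exact eq_div_of_mul_eq hg0' h
    · have h := hψmk (f r) ⟨g r, (hM _).2 hgc⟩
      rw [eq_div_of_mul_eq hgc h, ← V.valuation_le_one_iff, map_div₀, map_div₀]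
      refine div_le_one_of_le₀ (hc _ hfT _ hgT ?_) zero_le
      have hrV := (V.valuation_le_one_iff _).2 (hF r hr)
      rw [Polynomial.aeval_algebraMap_apply, Polynomial.aeval_algebraMap_apply]
      have e : algebraMap E L (aeval t (f r)) =
          algebraMap E L r * algebraMap E L (aeval t (g r)) := by
        rw [← map_mul]
        exact congrArg _ ((div_eq_iff hg0').1 (hfg r).symm)
      rw [e, map_mul]
      refine mul_le_of_le_one_left' ?_
      exact hrV

/-- Finitely many elements of a valuation ring that are algebraic over a simple transcendental
extension of `K` specialize to `K`. -/
theorem exists_specialization_of_algebraic [IsAlgClosed K] (V : ValuationSubring L) {π : K}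
    (hπ0 : π ≠ 0) (hπ : V.valuation (algebraMap K L π) < 1) {E : Type*} [Field E] [Algebra K E]
    [Algebra E L] [IsScalarTower K E L] {t : E} (ht : t ∉ Set.range (algebraMap K E))
    (hE : ∀ r : E, ∃ f g : K[X], r = aeval t f / aeval t g) {ι : Type*} [Finite ι] (s : ι → L)
    (hs : ∀ i, s i ∈ V) (hsa : ∀ i, IsAlgebraic E (s i)) :
    ∃ p : ι → K, (∀ i, algebraMap K L (p i) ∈ V) ∧
      ∀ f : MvPolynomial ι K, MvPolynomial.aeval s f = 0 → MvPolynomial.aeval p f = 0 := by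
  classical
  cases nonempty_fintype ι
  let W : ValuationSubring E := V.comap (algebraMap E L)
  let _ : Algebra W L := ((algebraMap E L).comp (algebraMap W E)).toAlgebra
  have : IsScalarTower W E L := IsScalarTower.of_algebraMap_eq fun _ => rfl
  have hWV : ∀ r : W, algebraMap W L r ∈ V := fun r => r.2
  have hb : ∀ i, ∃ b, V.valuation b = 1 ∧ IsIntegral W b ∧ IsIntegral W (b * s i) := by
    intro i
    obtain ⟨f, hf0, hf⟩ := hsa i
    obtain ⟨q, u, hq, k, hk⟩ := exists_primitive_polynomial W hf0
    refine exists_integral_unit_denominator V hWV (hs i) q ?_ ⟨k, by rw [hk]; simp⟩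
    rw [← Polynomial.aeval_map_algebraMap E, hq, map_mul, hf, mul_zero]
  choose b₀ hb₀v hb₀ hb₀s using hb
  set b := ∏ i, b₀ i with hbdef
  have hbv : V.valuation b = 1 := by
    rw [hbdef, map_prod]
    exact Finset.prod_eq_one fun i _ => hb₀v i
  have hbint : IsIntegral W b := IsIntegral.prod _ fun i _ => hb₀ i
  have hbs : ∀ i, IsIntegral W (b * s i) := fun i => by
    rw [hbdef, ← Finset.mul_prod_erase _ _ (Finset.mem_univ i), mul_right_comm]
    exact (hb₀s i).mul (IsIntegral.prod _ fun i _ => hb₀ i)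
  set h := minpoly W b with hh
  have hmonic : h.Monic := minpoly.monic hbint
  have hE' : minpoly E b = h.map (algebraMap W E) :=
    minpoly.isIntegrallyClosed_eq_field_fractions' E hbint
  obtain ⟨j, hj, hjv⟩ := exists_coeff_val_eq_one V.valuation hmonic (algebraMap W L)
    (fun k => (V.valuation_le_one_iff _).2 (hWV _)) (minpoly.aeval W b) hbv
  choose g hg hgs using hbs
  let F : Finset E := h.coeffs.image (algebraMap W E) ∪
    (Finset.univ.biUnion fun i => (g i).coeffs.image (algebraMap W E)) ∪
    {(algebraMap W E (h.coeff j))⁻¹}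
  have hFV : ∀ r ∈ F, algebraMap E L r ∈ V := by
    intro r hr
    simp only [F, Finset.mem_union, Finset.mem_image, Finset.mem_biUnion,
      Finset.mem_singleton] at hr
    rcases hr with (⟨w, -, rfl⟩ | ⟨i, -, w, -, rfl⟩) | rfl
    · exact w.2
    · exact w.2
    · rw [← V.valuation_le_one_iff, map_inv₀, map_inv₀, ← IsScalarTower.algebraMap_apply, hjv]
      simp
  obtain ⟨A, _, _, φ, ψ, hφ, hlift⟩ := exists_specialization_of_simple V hπ0 hπ ht hE F hFV
  let R₁ : Subring (A) := V.toSubring.comap ((algebraMap K L).comp ψ.toRingHom)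
  let φ₁ : R₁ →+* E := φ.toRingHom.comp R₁.subtype
  let ψ₁ : R₁ →+* K := ψ.toRingHom.comp R₁.subtype
  have hψ₁ : ∀ r, V.valuation (algebraMap K L (ψ₁ r)) ≤ 1 := fun r =>
    (V.valuation_le_one_iff _).2 r.2
  have hFr : ∀ r ∈ F, ∃ x, φ₁ x = r := fun r hr => by
    obtain ⟨x, hx, hxV⟩ := hlift r hr
    exact ⟨⟨x, hxV⟩, hx⟩
  have hlifts : ∀ q : W[X], (∀ w ∈ q.coeffs, algebraMap W E w ∈ F) →
      q.map (algebraMap W E) ∈ lifts φ₁ := fun q hq => by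
    refine (lifts_iff_coeff_lifts _).2 fun n => ?_
    rw [Polynomial.coeff_map]
    by_cases h0 : q.coeff n = 0
    · exact ⟨0, by simp [h0]⟩
    · exact hFr _ (hq _ (coeff_mem_coeffs h0))
  obtain ⟨h₁, hh₁, hdeg₁, hmon₁⟩ := lifts_and_natDegree_eq_and_monic (hlifts h fun w hw => by
    simp only [F, Finset.mem_union, Finset.mem_image]
    exact .inl (.inl ⟨w, hw, rfl⟩)) (hmonic.map _)
  have hg₁ : ∀ i, ∃ q : R₁[X], q.map φ₁ = (g i).map (algebraMap W E) ∧
      q.natDegree = ((g i).map (algebraMap W E)).natDegree ∧ q.Monic := fun i =>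
    lifts_and_natDegree_eq_and_monic (hlifts (g i) fun w hw => by
      simp only [F, Finset.mem_union, Finset.mem_image, Finset.mem_biUnion]
      exact .inl (.inr ⟨i, Finset.mem_univ _, w, hw, rfl⟩)) ((hg i).map _)
  choose g₁ hgmap _ hgmon using hg₁
  let v : Valuation K V.ValueGroup := V.valuation.comap (algebraMap K L)
  have hjunit : v (ψ₁ (h₁.coeff j)) = 1 := by
    obtain ⟨x, hx⟩ := hFr (algebraMap W E (h.coeff j))⁻¹ (by simp [F])
    have hcj : φ₁ (h₁.coeff j) = algebraMap W E (h.coeff j) := by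
      rw [← Polynomial.coeff_map, hh₁, Polynomial.coeff_map]
    have hne : algebraMap W E (h.coeff j) ≠ 0 := by
      intro h0
      rw [IsScalarTower.algebraMap_apply W E L, h0] at hjv
      simp at hjv
    have hone : h₁.coeff j * x = 1 := by
      apply Subtype.ext
      apply hφ
      have : φ₁ (h₁.coeff j * x) = 1 := by rw [map_mul, hcj, hx, mul_inv_cancel₀ hne]
      exact this.trans (map_one φ).symm
    have hvone : v (ψ₁ (h₁.coeff j)) * v (ψ₁ x) = 1 := by
      rw [← map_mul, ← map_mul, hone, map_one, map_one]
    refine le_antisymm (hψ₁ _) ?_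
    rw [← hvone]
    exact mul_le_of_le_one_right' (hψ₁ x)
  have hnd : h₁.natDegree = h.natDegree := by rw [hdeg₁, hmonic.natDegree_map]
  obtain ⟨β, hβ, hβv⟩ := exists_root_val_eq_one v (hmon₁.map ψ₁)
    (fun k => by rw [Polynomial.coeff_map]; exact hψ₁ _)
    ⟨j, by rw [hmon₁.natDegree_map, hnd]; exact hj, by rw [Polynomial.coeff_map]; exact hjunit⟩
  have hβ0 : β ≠ 0 := by rintro rfl; simp at hβv
  let θ : A →+* L := (algebraMap E L).comp φ.toRingHom
  let Φ : (A)[X] →+* L := eval₂RingHom θ b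
  let Ψ : (A)[X] →+* K := eval₂RingHom ψ.toRingHom β
  have hker : RingHom.ker Φ ≤ RingHom.ker Ψ := by
    refine ker_eval₂RingHom_le hφ (hmon₁.map R₁.subtype) ?_ ?_
    · rw [hE', ← hh₁, Polynomial.map_map]
    · rw [IsRoot.def, Polynomial.eval_map] at hβ
      rw [Polynomial.eval₂_map]
      exact hβ
  have : (RingHom.ker Ψ).IsPrime := RingHom.ker_isPrime Ψ
  obtain ⟨U, hU, hUP⟩ := exists_valuationSubring_center Φ (RingHom.ker Ψ) hker
  have hθK : ∀ a : K, θ (algebraMap K _ a) = algebraMap K L a := fun a => by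
    change algebraMap E L (φ (algebraMap K _ a)) = _
    rw [AlgHom.commutes, ← IsScalarTower.algebraMap_apply]
  have hψK : ∀ a : K, ψ.toRingHom (algebraMap K _ a) = a := fun a => ψ.commutes a
  have hΦC : ∀ r, Φ (Polynomial.C r) = θ r := fun r => eval₂_C _ _
  have hΨC : ∀ r, Ψ (Polynomial.C r) = ψ.toRingHom r := fun r => eval₂_C _ _
  have hΦX : Φ Polynomial.X = b := eval₂_X _ _
  have hΨX : Ψ Polynomial.X = β := eval₂_X _ _
  have hUK : ∀ a : K, U.valuation (algebraMap K L a) ≤ 1 := fun a => by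
    rw [U.valuation_le_one_iff, ← hθK, ← hΦC]
    exact hU _
  have hθψ : ∀ r, U.valuation (θ r - algebraMap K L (ψ.toRingHom r)) < 1 := fun r => by
    have := (hUP (Polynomial.C r - Polynomial.C (algebraMap K _ (ψ.toRingHom r)))).1 (by
      rw [RingHom.mem_ker, map_sub, hΨC, hΨC, hψK, sub_self])
    rwa [map_sub, hΦC, hΦC, hθK] at this
  have hbβ : U.valuation (b - algebraMap K L β) < 1 := by
    have := (hUP (Polynomial.X - Polynomial.C (algebraMap K _ β))).1 (by
      rw [RingHom.mem_ker, map_sub, hΨC, hΨX, hψK, sub_self])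
    rwa [map_sub, hΦC, hΦX, hθK] at this
  have hbU : U.valuation b = 1 := by
    refine le_antisymm ((U.valuation_le_one_iff _).2 (hΦX ▸ hU _)) (not_lt.1 fun hlt => hβ0 ?_)
    rw [← hΦX, ← hUP, RingHom.mem_ker, hΨX] at hlt
    exact hlt
  have hα : ∀ i, ∃ α, eval₂ ψ₁ α (g₁ i) = 0 ∧ U.valuation (b * s i - algebraMap K L α) < 1 := by
    intro i
    refine exists_root_congr hUK (θ.comp R₁.subtype) ψ₁ (fun r => hθψ r) (hgmon i) ?_
    have : eval₂ (θ.comp R₁.subtype) (b * s i) (g₁ i) =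
        eval₂ (algebraMap E L) (b * s i) ((g₁ i).map φ₁) := by
      rw [Polynomial.eval₂_map]; rfl
    rw [this, hgmap, Polynomial.eval₂_map]
    exact hgs i
  choose α hα hαU using hα
  refine ⟨fun i => α i / β, fun i => ?_, aeval_eq_zero_of_congr hUK fun i => ?_⟩
  · have h1 : v (α i) ≤ 1 := val_root_le_one v (hgmon i) ψ₁ (fun _ => hψ₁ _) (hα i)
    have h2 : v (α i / β) ≤ 1 := by rw [map_div₀, hβv, div_one]; exact h1
    exact (V.valuation_le_one_iff _).1 h2
  · have hb0 : b ≠ 0 := by rintro h0; rw [h0] at hbU; simp at hbU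
    have hβL : algebraMap K L β ≠ 0 := by simpa using hβ0
    have e : b * (s i - algebraMap K L (α i / β)) = (b * s i - algebraMap K L (α i)) -
        (b - algebraMap K L β) * algebraMap K L (α i / β) := by
      rw [map_div₀]; field_simp; ring
    have h3 : U.valuation (b * (s i - algebraMap K L (α i / β))) < 1 := by
      rw [e]
      refine U.valuation.map_sub_lt (hαU i) ?_
      rw [map_mul]
      exact mul_lt_one_of_lt_of_le hbβ (hUK _)
    rwa [map_mul, hbU, one_mul] at h3

/-- An algebraically closed field with a nontrivial valuation is existentially closed in its
algebraically closed valued extensions. -/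
theorem exists_specialization {L : Type u} [Field L] [IsAlgClosed L] (V : ValuationSubring L)
    {ι : Type*} [Finite ι] (s : ι → L) (hs : ∀ i, s i ∈ V) (T : Finset ι) :
    ∀ {K : Type u} [Field K] [IsAlgClosed K] [Algebra K L] {π : K} (_ : π ≠ 0)
      (_ : V.valuation (algebraMap K L π) < 1)
      (_ : ∀ i, i ∉ T → s i ∈ Set.range (algebraMap K L)),
      ∃ p : ι → K, (∀ i, algebraMap K L (p i) ∈ V) ∧
        ∀ f : MvPolynomial ι K, MvPolynomial.aeval s f = 0 → MvPolynomial.aeval p f = 0 := by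
  classical
  induction T using Finset.induction_on with
  | empty =>
    intro K _ _ _ π _ _ hT
    choose p hp using fun i => hT i (Finset.notMem_empty i)
    refine ⟨p, fun i => hp i ▸ hs i, fun f hf => ?_⟩
    have e : s = fun i => algebraMap K L (p i) := funext fun i => (hp i).symm
    rw [e] at hf
    refine (algebraMap K L).injective ?_
    rw [map_zero, ← hf]
    exact (MvPolynomial.aeval_algebraMap_apply L p f).symm
  | insert j T' hj ih =>
    intro K _ _ _ π hπ0 hπ hT
    by_cases hsj : s j ∈ Set.range (algebraMap K L)
    · refine ih hπ0 hπ fun i hi => ?_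
      by_cases hij : i = j
      · exact hij ▸ hsj
      · exact hT i (by simp [hij, hi])
    let E := IntermediateField.adjoin K {s j}
    let K' := algebraicClosure E L
    have hsE : s j ∈ E := IntermediateField.mem_adjoin_simple_self K (s j)
    have hclosed : IsAlgClosed K' := (algebraicClosure.isAlgClosure E L).isAlgClosed
    have htower : IsScalarTower K K' L := IsScalarTower.of_algebraMap_eq fun _ => rfl
    have hK : ∀ a : K, algebraMap K' L (algebraMap K K' a) = algebraMap K L a := fun _ => rfl
    obtain ⟨p', hp'V, hp'⟩ := ih (K := K') (π := algebraMap K K' π) (by simpa using hπ0)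
      (by rw [hK]; exact hπ) (fun i hi => by
        by_cases hij : i = j
        · exact ⟨algebraMap E K' ⟨s j, hsE⟩, congrArg s hij.symm⟩
        · obtain ⟨a, ha⟩ := hT i (by simp [hij, hi])
          exact ⟨algebraMap K K' a, ha⟩)
    obtain ⟨p, hpV, hp⟩ := exists_specialization_of_algebraic V hπ0 hπ (E := E) (t := ⟨s j, hsE⟩)
      (fun ⟨a, ha⟩ => hsj ⟨a, congrArg Subtype.val ha⟩)
      (fun r => by
        obtain ⟨f, g, hfg⟩ := (IntermediateField.mem_adjoin_simple_iff K (r : L)).1 r.2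
        refine ⟨f, g, Subtype.ext ?_⟩
        rw [hfg]
        have e : ∀ q : K[X], aeval (s j) q = ((aeval (⟨s j, hsE⟩ : E) q : E) : L) :=
          Polynomial.aeval_algebraMap_apply L (⟨s j, hsE⟩ : E)
        rw [e, e]
        exact (map_div₀ (algebraMap E L) _ _).symm)
      (fun i => (p' i : L)) hp'V (fun i => mem_algebraicClosure_iff.1 (p' i).2)
    refine ⟨p, hpV, fun f hf => hp f ?_⟩
    have h := hp' (MvPolynomial.map (algebraMap K K') f) (by
      rw [MvPolynomial.aeval_map_algebraMap]; exact hf)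
    rw [MvPolynomial.aeval_map_algebraMap] at h
    rw [← map_zero (algebraMap K' L), ← h]
    exact MvPolynomial.aeval_algebraMap_apply L p' f

end ModelCompleteness

section TropicalPoints

universe u

/-- The pairing of an exponent with a weight vector. -/
noncomputable def weightPairing {n : ℕ} (w : Fin n → ℝ) : (Fin n →₀ ℕ) →+ ℝ where
  toFun a := ∑ i, (a i : ℝ) * w i
  map_zero' := by simp
  map_add' a b := by simp [add_mul, Finset.sum_add_distrib]

lemma weightPairing_single {n : ℕ} (w : Fin n → ℝ) (i : Fin n) :
    weightPairing w (Finsupp.single i 1) = w i := by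
  simp [weightPairing, Finsupp.single_apply]

lemma withTop_neg_lt_iff (x : WithTop ℝ) (r : ℝ) : ((-r : ℝ) : WithTop ℝ) < x ↔ 0 < x + r := by
  induction x using WithTop.recTopCoe with
  | top => exact iff_of_true (WithTop.coe_lt_top _) (by simp)
  | coe x =>
    norm_cast
    exact neg_lt_iff_pos_add

lemma withTop_neg_add_cancel (r : ℝ) : ((-r : ℝ) : WithTop ℝ) + r = 0 := by
  norm_cast
  simp

variable {K : Type u} [Field K] {n : ℕ} (v : AddValuation K (WithTop ℝ)) (w : Fin n → ℝ)

lemma mul_coeff_val_ge {f g : MvPolynomial (Fin n) K}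
    (hf : ∀ a, ((-weightPairing w a : ℝ) : WithTop ℝ) ≤ v (coeff a f))
    (hg : ∀ a, ((-weightPairing w a : ℝ) : WithTop ℝ) ≤ v (coeff a g)) (a : Fin n →₀ ℕ) :
    ((-weightPairing w a : ℝ) : WithTop ℝ) ≤ v (coeff a (f * g)) := by
  rw [coeff_mul]
  refine v.map_le_sum fun x hx => ?_
  rw [← Finset.HasAntidiagonal.mem_antidiagonal.1 hx, map_add, neg_add, v.map_mul, WithTop.coe_add]
  exact add_le_add (hf _) (hg _)

lemma mul_coeff_val_gt {f g : MvPolynomial (Fin n) K}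
    (hf : ∀ a, ((-weightPairing w a : ℝ) : WithTop ℝ) ≤ v (coeff a f))
    (hg : ∀ a, ((-weightPairing w a : ℝ) : WithTop ℝ) < v (coeff a g)) (a : Fin n →₀ ℕ) :
    ((-weightPairing w a : ℝ) : WithTop ℝ) < v (coeff a (f * g)) := by
  rw [coeff_mul]
  refine v.map_lt_sum WithTop.coe_ne_top fun x hx => ?_
  rw [← Finset.HasAntidiagonal.mem_antidiagonal.1 hx, map_add, neg_add, v.map_mul, WithTop.coe_add]
  exact WithTop.add_lt_add_of_le_of_lt WithTop.coe_ne_top (hf _) (hg _)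

lemma monomial_coeff_val_ge {b : Fin n →₀ ℕ} {c : K}
    (hc : ((-weightPairing w b : ℝ) : WithTop ℝ) ≤ v c) (a : Fin n →₀ ℕ) :
    ((-weightPairing w a : ℝ) : WithTop ℝ) ≤ v (coeff a (monomial b c)) := by
  classical
  rw [coeff_monomial]
  split_ifs with h
  · exact h ▸ hc
  · simp

/-- The polynomials all of whose terms have nonnegative tropical value at `w`. -/
def gaussSubring : Subring (MvPolynomial (Fin n) K) where
  carrier := {f | ∀ a, ((-weightPairing w a : ℝ) : WithTop ℝ) ≤ v (coeff a f)}
  mul_mem' := mul_coeff_val_ge v w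
  one_mem' := monomial_coeff_val_ge v w (by simp)
  add_mem' hf hg a := by
    rw [coeff_add]
    exact v.map_le_add (hf a) (hg a)
  zero_mem' a := by simp
  neg_mem' hf a := by
    rw [coeff_neg, v.map_neg]
    exact hf a

/-- The polynomials all of whose terms have positive tropical value at `w`. -/
def gaussIdeal : Ideal (gaussSubring v w) where
  carrier := {f | ∀ a, ((-weightPairing w a : ℝ) : WithTop ℝ) < v (coeff a f.1)}
  add_mem' hf hg a := by
    rw [Subring.coe_add, coeff_add]
    exact v.map_lt_add (hf a) (hg a)
  zero_mem' a := by
    rw [Subring.coe_zero, coeff_zero, v.map_zero]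
    exact WithTop.coe_lt_top _
  smul_mem' f _ hg a := mul_coeff_val_gt v w f.2 hg a

/-- The monomials of tropical value zero at `w`. -/
def unitMonomials : Submonoid (gaussSubring v w) where
  carrier := {f | ∃ b c, f.1 = monomial b c ∧ v c = ((-weightPairing w b : ℝ) : WithTop ℝ)}
  mul_mem' := by
    rintro f g ⟨b, c, hf, hc⟩ ⟨b', c', hg, hc'⟩
    refine ⟨b + b', c * c', ?_, ?_⟩
    · rw [Subring.coe_mul, hf, hg, monomial_mul]
    · rw [v.map_mul, hc, hc', map_add, neg_add, WithTop.coe_add]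
  one_mem' := ⟨0, 1, rfl, by simp⟩

lemma disjoint_unitMonomials {I : Ideal (MvPolynomial (Fin n) K)}
    (hw : ∀ f ∈ I, f ≠ 0 → w ∈ cornerLocus v f) :
    Disjoint ((I.comap (gaussSubring v w).subtype ⊔ gaussIdeal v w :
      Ideal (gaussSubring v w)) : Set (gaussSubring v w)) (unitMonomials v w) := by
  classical
  rw [Set.disjoint_left]
  rintro y hy ⟨b, c, hyb, hc⟩
  obtain ⟨g, hg, μ, hμ, rfl⟩ := Submodule.mem_sup.1 hy
  have hgb : v (coeff b g.1) = ((-weightPairing w b : ℝ) : WithTop ℝ) := by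
    have h : coeff b g.1 = c - coeff b μ.1 := by
      have := congrArg (coeff b) hyb
      rw [Subring.coe_add, coeff_add, coeff_monomial, if_pos rfl] at this
      rw [← this, add_sub_cancel_right]
    rw [h, v.map_sub_eq_of_lt_left (hc ▸ hμ b), hc]
  have hga : ∀ a, a ≠ b → ((-weightPairing w a : ℝ) : WithTop ℝ) < v (coeff a g.1) := by
    intro a hab
    have h : coeff a g.1 = -coeff a μ.1 := by
      have := congrArg (coeff a) hyb
      rw [Subring.coe_add, coeff_add, coeff_monomial, if_neg hab.symm] at this
      exact eq_neg_of_add_eq_zero_left this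
    rw [h, v.map_neg]
    exact hμ a
  have htb : tropTerm v g.1 w b = 0 := by
    unfold tropTerm
    rw [hgb]
    exact withTop_neg_add_cancel _
  have hta : ∀ a, a ≠ b → 0 < tropTerm v g.1 w a := fun a ha =>
    (withTop_neg_lt_iff _ _).1 (hga a ha)
  have hbs : b ∈ g.1.support := by
    rw [mem_support_iff]
    intro h0
    rw [h0, v.map_zero] at hgb
    exact WithTop.top_ne_coe hgb
  obtain ⟨a, -, a', -, haa, heq, hmin⟩ := hw g.1 hg (by rintro h0; simp [h0] at hbs)
  have hle := hmin b hbs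
  rw [htb] at hle
  by_cases hab : a = b
  · have h1 := hta a' (fun h => haa (hab.trans h.symm))
    rw [← heq] at h1
    exact hle.not_gt h1
  · exact hle.not_gt (hta a hab)

lemma exists_algClosed_hom_ker_eq {A : Type u} [CommRing A] (Q : Ideal A) [Q.IsPrime] :
    ∃ (L : Type u) (_ : Field L) (_ : IsAlgClosed L) (φ : A →+* L), RingHom.ker φ = Q := by
  refine ⟨AlgebraicClosure (FractionRing (A ⧸ Q)), inferInstance, inferInstance,
    (algebraMap (FractionRing (A ⧸ Q)) (AlgebraicClosure (FractionRing (A ⧸ Q)))).comp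
      ((algebraMap (A ⧸ Q) (FractionRing (A ⧸ Q))).comp (Ideal.Quotient.mk Q)), ?_⟩
  ext a
  simp [RingHom.mem_ker, Ideal.Quotient.eq_zero_iff_mem]

/-- A weight vector in every corner locus of an ideal lifts to a zero of the ideal in the torus. -/
theorem exists_zero_of_mem_cornerLocus [IsAlgClosed K] (hsurj : Function.Surjective v)
    {I : Ideal (MvPolynomial (Fin n) K)} (hw : ∀ f ∈ I, f ≠ 0 → w ∈ cornerLocus v f) :
    ∃ p : Fin n → K, (∀ i, p i ≠ 0) ∧ (∀ f ∈ I, eval p f = 0) ∧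
      ∀ i, (w i : WithTop ℝ) = v (p i) := by
  choose τ hτ using fun i => hsurj (w i : WithTop ℝ)
  have hτ0 : ∀ i, τ i ≠ 0 := fun i => by
    rw [← v.ne_top_iff, hτ]
    exact WithTop.coe_ne_top
  obtain ⟨π, hπ⟩ := hsurj ((1 : ℝ) : WithTop ℝ)
  have hπ0 : π ≠ 0 := by
    rw [← v.ne_top_iff, hπ]
    exact WithTop.coe_ne_top
  obtain ⟨P, hP, hPI, hPS⟩ := Ideal.exists_le_prime_disjoint _ _ (disjoint_unitMonomials v w hw)
  have hdisj : Disjoint (I : Set (MvPolynomial (Fin n) K))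
      (P.primeCompl.map (gaussSubring v w).subtype) := by
    rw [Set.disjoint_left]
    rintro _ hf ⟨r, hr, rfl⟩
    exact hr (hPI (Ideal.mem_sup_left hf))
  obtain ⟨Q, hQ, hQI, hQP⟩ := Ideal.exists_le_prime_disjoint _ _ hdisj
  obtain ⟨L, _, _, φ, hφ⟩ := exists_algClosed_hom_ker_eq Q
  obtain ⟨V, hVR, hVP⟩ := exists_valuationSubring_center (φ.comp (gaussSubring v w).subtype) P (by
    intro r hr
    by_contra hrP
    have hrQ : r.1 ∈ Q := hφ ▸ hr
    exact Set.disjoint_left.1 hQP hrQ ⟨r, hrP, rfl⟩)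
  let _ : Algebra K L := (φ.comp C).toAlgebra
  have hKL : ∀ a, algebraMap K L a = φ (C a) := fun _ => rfl
  have hpos : ∀ a : K, 0 < v a → V.valuation (algebraMap K L a) < 1 := by
    intro a ha
    have hmem : C a ∈ gaussSubring v w := monomial_coeff_val_ge v w (by simpa using ha.le)
    refine (hVP ⟨C a, hmem⟩).1 (hPI (Ideal.mem_sup_right fun b => ?_))
    classical
    rw [coeff_C]
    split_ifs with h
    · simpa [← h] using ha
    · rw [v.map_zero]
      exact WithTop.coe_lt_top _
  have hnonneg : ∀ a : K, algebraMap K L a ∈ V → 0 ≤ v a := by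
    intro a ha
    by_contra! hlt
    have ha0 : a ≠ 0 := by
      rintro rfl
      simp at hlt
    have hinv : 0 < v a⁻¹ := by
      by_contra! hle
      have : v (a * a⁻¹) < 0 := by
        rw [v.map_mul]
        exact (add_le_add_right hle _).trans_lt (by simpa using hlt)
      rw [mul_inv_cancel₀ ha0, v.map_one] at this
      exact this.false
    have h1 := hpos _ hinv
    have h2 : V.valuation (algebraMap K L a⁻¹) * V.valuation (algebraMap K L a) = 1 := by
      rw [← map_mul, ← map_mul, inv_mul_cancel₀ ha0, map_one, map_one]
    exact (mul_lt_one_of_lt_of_le h1 ((V.valuation_le_one_iff _).2 ha)).ne h2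
  have hyv : ∀ i, v (τ i)⁻¹ = ((-weightPairing w (Finsupp.single i 1) : ℝ) : WithTop ℝ) := by
    intro i
    rw [weightPairing_single, v.map_inv, hτ]
    rfl
  let y : Fin n → gaussSubring v w := fun i =>
    ⟨monomial (Finsupp.single i 1) (τ i)⁻¹, monomial_coeff_val_ge v w (hyv i).ge⟩
  have hyP : ∀ i, y i ∉ P := fun i hi => Set.disjoint_left.1 hPS hi ⟨_, _, rfl, hyv i⟩
  let s : Fin n → L := fun i => φ (y i).1
  have hsV : ∀ i, V.valuation (s i) = 1 := fun i =>
    le_antisymm ((V.valuation_le_one_iff _).2 (hVR (y i)))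
      (not_lt.1 fun h => hyP i ((hVP (y i)).2 h))
  have hs0 : ∀ i, s i ≠ 0 := fun i h => by
    have := hsV i
    rw [h, map_zero] at this
    exact zero_ne_one this
  have hτs : ∀ i, algebraMap K L (τ i) * s i = φ (X i) := fun i => by
    rw [hKL, ← map_mul, C_mul_monomial, mul_inv_cancel₀ (hτ0 i)]
    rfl
  obtain ⟨p, hpV, hp⟩ := exists_specialization V (ι := Fin n ⊕ Fin n)
    (Sum.elim s fun i => (s i)⁻¹)
    (by
      rintro (i | i)
      · exact hVR (y i)
      · rw [← V.valuation_le_one_iff]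
        simp [hsV])
    Finset.univ hπ0 (hpos π (by rw [hπ]; norm_cast))
    (fun i hi => absurd (Finset.mem_univ i) hi)
  have hmul : ∀ i, p (.inl i) * p (.inr i) = 1 := fun i => by
    have := hp (X (.inl i) * X (.inr i) - 1) (by simp [hs0])
    simpa [sub_eq_zero] using this
  have hpv : ∀ i, v (p (.inl i)) = 0 := fun i => by
    have h := congrArg v (hmul i)
    rw [v.map_mul, v.map_one] at h
    refine le_antisymm ?_ (hnonneg _ (hpV _))
    rw [← h]
    exact le_add_of_nonneg_right (hnonneg _ (hpV _))
  refine ⟨fun i => τ i * p (.inl i), fun i => mul_ne_zero (hτ0 i) ?_, fun f hf => ?_, fun i => ?_⟩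
  · exact left_ne_zero_of_mul_eq_one (hmul i)
  · let g : MvPolynomial (Fin n ⊕ Fin n) K := aeval (fun i => C (τ i) * X (.inl i)) f
    have hev : ∀ (M : Type _) [Field M] [Algebra K M] (q : Fin n ⊕ Fin n → M),
        aeval q g = aeval (fun i => algebraMap K M (τ i) * q (.inl i)) f := by
      intro M _ _ q
      rw [comp_aeval_apply]
      simp
    have h0 := hp g (by
      rw [hev]
      simp only [Sum.elim_inl, hτs]
      have : φ f = 0 := by
        rw [← RingHom.mem_ker, hφ]
        exact hQI hf
      let Φ : MvPolynomial (Fin n) K →ₐ[K] L := { φ with commutes' := fun _ => rfl }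
      rw [← this]
      exact (DFunLike.congr_fun (aeval_unique Φ) f).symm)
    rw [hev] at h0
    exact h0
  · rw [v.map_mul, hτ, hpv, add_zero]

lemma isClosed_cornerLocus (f : MvPolynomial (Fin n) K) : IsClosed (cornerLocus v f) := by
  have hc : ∀ a ∈ f.support, ∃ c : ℝ, v (coeff a f) = c := fun a ha => by
    obtain ⟨c, hc⟩ := WithTop.ne_top_iff_exists.1 (v.ne_top_iff.2 (mem_support_iff.1 ha))
    exact ⟨c, hc.symm⟩
  choose! c hc using hc
  have ht : ∀ w, ∀ a ∈ f.support,
      tropTerm v f w a = ((c a + ∑ i, (a i : ℝ) * w i : ℝ) : WithTop ℝ) := fun w a ha => by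
    rw [tropTerm, hc a ha, WithTop.coe_add]
  have hcont : ∀ a : Fin n →₀ ℕ, Continuous fun w : Fin n → ℝ => c a + ∑ i, (a i : ℝ) * w i :=
    fun a => by fun_prop
  have h : cornerLocus v f = ⋃ a ∈ f.support, ⋃ b ∈ f.support.erase a,
      {w | c a + ∑ i, (a i : ℝ) * w i = c b + ∑ i, (b i : ℝ) * w i} ∩
        ⋂ e ∈ f.support, {w | c a + ∑ i, (a i : ℝ) * w i ≤ c e + ∑ i, (e i : ℝ) * w i} := by
    ext w
    simp only [cornerLocus, Set.mem_ofPred_eq, Set.mem_iUnion, Set.mem_inter_iff, Set.mem_iInter,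
      Finset.mem_erase, exists_prop]
    refine exists_congr fun a => and_congr_right fun ha => exists_congr fun b => ?_
    constructor
    · rintro ⟨hb, hab, heq, hmin⟩
      rw [ht w a ha, ht w b hb, WithTop.coe_inj] at heq
      refine ⟨⟨hab.symm, hb⟩, heq, fun e he => ?_⟩
      have := hmin e he
      rwa [ht w a ha, ht w e he, WithTop.coe_le_coe] at this
    · rintro ⟨⟨hab, hb⟩, heq, hmin⟩
      refine ⟨hb, hab.symm, ?_, fun e he => ?_⟩
      · rw [ht w a ha, ht w b hb, heq]
      · rw [ht w a ha, ht w e he, WithTop.coe_le_coe]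
        exact hmin e he
  rw [h]
  refine isClosed_biUnion_finset fun a _ => isClosed_biUnion_finset fun b _ =>
    (isClosed_eq (hcont a) (hcont b)).inter ?_
  exact isClosed_biInter fun e _ => isClosed_le (hcont a) (hcont e)

lemma mem_cornerLocus_of_eval_eq_zero {p : Fin n → K} (hp : ∀ i, (w i : WithTop ℝ) = v (p i))
    {f : MvPolynomial (Fin n) K} (hf0 : f ≠ 0) (hf : eval p f = 0) : w ∈ cornerLocus v f := by
  classical
  have hterm : ∀ a, v (coeff a f * ∏ i, p i ^ a i) = tropTerm v f w a := by
    intro a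
    have hprod : ∀ s : Finset (Fin n), v (∏ i ∈ s, p i ^ a i) =
        ((∑ i ∈ s, (a i : ℝ) * w i : ℝ) : WithTop ℝ) := by
      intro s
      induction s using Finset.induction_on with
      | empty => simp
      | insert i s hi ih =>
        rw [Finset.prod_insert hi, Finset.sum_insert hi, v.map_mul, ih, v.map_pow, ← hp,
          WithTop.coe_add, ← nsmul_eq_mul, WithTop.coe_nsmul]
    rw [v.map_mul, hprod, tropTerm]
  obtain ⟨a, ha, hmin⟩ := Finset.exists_min_image f.support (tropTerm v f w)
    (support_nonempty.2 hf0)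
  by_contra hw
  have hlt : ∀ b ∈ f.support.erase a, tropTerm v f w a < tropTerm v f w b := fun b hb => by
    have hbs := Finset.mem_of_mem_erase hb
    refine (hmin b hbs).lt_of_ne fun h => hw ?_
    exact ⟨a, ha, b, hbs, (Finset.ne_of_mem_erase hb).symm, h, hmin⟩
  rw [eval_eq', ← Finset.add_sum_erase _ _ ha] at hf
  have hne : tropTerm v f w a ≠ ⊤ :=
    WithTop.add_ne_top.2 ⟨v.ne_top_iff.2 (mem_support_iff.1 ha), WithTop.coe_ne_top⟩
  have h := v.map_lt_sum hne fun b hb => (hlt b hb).trans_eq (hterm b).symm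
  rw [← hterm a, eq_neg_of_add_eq_zero_left hf, v.map_neg] at h
  exact h.false

end TropicalPoints

/-- Fundamental theorem of tropical geometry: over an algebraically closed
field with a surjective valuation `v : K → ℝ ∪ {∞}`, the intersection of the
corner loci of the tropicalizations of all nonzero `f ∈ I` equals the closure
of the image under coordinatewise valuation of the zero locus of `I` in the
torus `(K*)ⁿ`. -/
theorem tropical_variety_eq_closure_amoeba {K : Type*} [Field K] [IsAlgClosed K]
    {n : ℕ} (v : K → WithTop ℝ)
    (hv_mul : ∀ a b : K, v (a * b) = v a + v b)
    (hv_add : ∀ a b : K, min (v a) (v b) ≤ v (a + b))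
    (hv_top : ∀ a : K, v a = ⊤ ↔ a = 0)
    (hv_surj : Function.Surjective v)
    (I : Ideal (MvPolynomial (Fin n) K)) :
    (⋂ f ∈ {f : MvPolynomial (Fin n) K | f ∈ I ∧ f ≠ 0}, cornerLocus v f) =
      closure {w : Fin n → ℝ | ∃ p : Fin n → K, (∀ i, p i ≠ 0) ∧
        (∀ f ∈ I, eval p f = 0) ∧ ∀ i, (w i : WithTop ℝ) = v (p i)} := by
  obtain ⟨u, rfl⟩ : ∃ u : AddValuation K (WithTop ℝ), ⇑u = v := by
    have h1 : v 1 = 0 := by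
      have h := hv_mul 1 1
      have hne : v 1 ≠ ⊤ := fun h => one_ne_zero ((hv_top 1).1 h)
      rw [mul_one] at h
      obtain ⟨r, hr⟩ := WithTop.ne_top_iff_exists.1 hne
      rw [← hr] at h ⊢
      norm_cast at h ⊢
      linarith
    exact ⟨AddValuation.of v ((hv_top 0).2 rfl) h1 hv_add hv_mul, rfl⟩
  refine Set.Subset.antisymm (fun w hw => subset_closure ?_) (closure_minimal ?_ ?_)
  · refine exists_zero_of_mem_cornerLocus u w hv_surj fun f hf hf0 => ?_
    exact Set.mem_iInter₂.1 hw f ⟨hf, hf0⟩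
  · rintro w ⟨p, -, hpI, hpw⟩
    exact Set.mem_iInter₂.2 fun f hf =>
      mem_cornerLocus_of_eval_eq_zero u w hpw hf.2 (hpI f hf.1)
  · exact isClosed_biInter fun f _ => isClosed_cornerLocus u f
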